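/- Let H be a complex Hilbert space and let T, W be bounded operators on H with ‖W‖ ≤ 1. If T = W|T|, then |T| = W*T. If moreover W is an orthogonal projection, then T is positive (and T = |T|). -/

import Mathlib

open ContinuousLinearMap

noncomputable def absOp {H K : Type*} [NormedAddCommGroup H] [InnerProductSpace ℂ H]
    [CompleteSpace H] [NormedAddCommGroup K] [InnerProductSpace ℂ K] [CompleteSpace K]
    (T : H →L[ℂ] K) : H →L[ℂ] H :=
  CFC.sqrt (ContinuousLinearMap.adjoint T ∘L T)

variable {H : Type*} [NormedAddCommGroup H] [InnerProductSpace ℂ H] [CompleteSpace H]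

/-- A contraction `W` which preserves the norm of `y` satisfies `W†W y = y`. -/
theorem adjoint_apply_apply_of_norm_eq {E F : Type*} [NormedAddCommGroup E]
    [InnerProductSpace ℂ E] [CompleteSpace E] [NormedAddCommGroup F] [InnerProductSpace ℂ F]
    [CompleteSpace F] {W : E →L[ℂ] F} (hW : ‖W‖ ≤ 1) {y : E} (hy : ‖W y‖ = ‖y‖) :
    ContinuousLinearMap.adjoint W (W y) = y := by
  have hle : ‖ContinuousLinearMap.adjoint W (W y)‖ ≤ ‖y‖ := by
    have hadj : ‖ContinuousLinearMap.adjoint W‖ ≤ 1 := by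
      rwa [LinearIsometryEquiv.norm_map]
    simpa [hy] using (ContinuousLinearMap.adjoint W).le_of_opNorm_le hadj (W y)
  have hsub := norm_sub_sq (𝕜 := ℂ) (ContinuousLinearMap.adjoint W (W y)) y
  rw [ContinuousLinearMap.adjoint_inner_left, inner_self_eq_norm_sq, hy] at hsub
  have hsq := pow_le_pow_left₀ (norm_nonneg _) hle 2
  rw [← sub_eq_zero, ← norm_eq_zero, ← sq_eq_zero_iff]
  exact le_antisymm (by linarith) (sq_nonneg _)

theorem absOp_isPositive {E F : Type*} [NormedAddCommGroup E]
    [InnerProductSpace ℂ E] [CompleteSpace E] [NormedAddCommGroup F] [InnerProductSpace ℂ F]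
    [CompleteSpace F] (T : E →L[ℂ] F) : (absOp T).IsPositive :=
  (ContinuousLinearMap.nonneg_iff_isPositive _).1 (CFC.sqrt_nonneg _)

theorem norm_absOp_apply {E F : Type*} [NormedAddCommGroup E]
    [InnerProductSpace ℂ E] [CompleteSpace E] [NormedAddCommGroup F] [InnerProductSpace ℂ F]
    [CompleteSpace F] (T : E →L[ℂ] F) (x : E) : ‖absOp T x‖ = ‖T x‖ := by
  have hsq : absOp T * absOp T = ContinuousLinearMap.adjoint T ∘L T :=
    CFC.sqrt_mul_sqrt_self _ ((ContinuousLinearMap.nonneg_iff_isPositive _).2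
      (ContinuousLinearMap.isPositive_adjoint_comp_self T))
  have hinner : inner ℂ (absOp T x) (absOp T x) = inner ℂ (T x) (T x) := by
    rw [← ContinuousLinearMap.adjoint_inner_left, (absOp_isPositive T).isSelfAdjoint.adjoint_eq,
      ← ContinuousLinearMap.adjoint_inner_left]
    exact congrArg (fun S : E →L[ℂ] E => inner ℂ (S x) x) hsq
  rw [inner_self_eq_norm_sq_to_K, inner_self_eq_norm_sq_to_K] at hinner
  exact (sq_eq_sq₀ (norm_nonneg _) (norm_nonneg _)).1 (by exact_mod_cast hinner)

theorem stmt7 (T W : H →L[ℂ] H) (hW : ‖W‖ ≤ 1) (h : T = W ∘L absOp T) :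
    absOp T = ContinuousLinearMap.adjoint W ∘L T ∧
      ((IsSelfAdjoint W ∧ W ∘L W = W) → T.IsPositive ∧ T = absOp T) := by
  have hTx (x : H) : T x = W (absOp T x) := congrArg (fun S : H →L[ℂ] H => S x) h
  have habs : absOp T = ContinuousLinearMap.adjoint W ∘L T := by
    ext x
    rw [ContinuousLinearMap.comp_apply, hTx,
      adjoint_apply_apply_of_norm_eq hW (by rw [← hTx, norm_absOp_apply])]
  refine ⟨habs, fun ⟨hsa, hidem⟩ => ?_⟩
  have hT : T = absOp T := by
    rw [hsa.adjoint_eq] at habs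
    calc T = W ∘L absOp T := h
      _ = (W ∘L W) ∘L absOp T := by rw [hidem]
      _ = W ∘L T := by rw [ContinuousLinearMap.comp_assoc, ← h]
      _ = absOp T := habs.symm
  exact ⟨hT ▸ absOp_isPositive T, hT⟩
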